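/- There are exactly 5 isomorphism classes of simple modules over the group algebra ℚ[SL(2, F₃)]; equivalently, SL(2, F₃) has exactly 5 isomorphism classes of irreducible rational representations. -/

import Mathlib

/-- The rational group algebra `ℚ[SL(2, F₃)]`. -/
noncomputable abbrev QSL₂F₃ : Type :=
  MonoidAlgebra ℚ (Matrix.SpecialLinearGroup (Fin 2) (ZMod 3))

universe u

/-- The group `SL(2, F₃)`. -/
abbrev G3 : Type := Matrix.SpecialLinearGroup (Fin 2) (ZMod 3)

/-- Bruhat normal form of the matrix `!![a, b; c, d]` as a word in two elements `S`, `T`. -/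
def word {M : Type*} [Monoid M] (S T : M) (a b c d : ZMod 3) : M :=
  if c = 0 then (if a = 1 then 1 else S * S) * T ^ (a * b).val
  else (if c = 1 then 1 else S * S) * (T ^ (a * c).val * (S * T ^ (d * c).val))

/-- Compatibility of the word map with left multiplication by the two generators. -/
def RepOK {n : ℕ} (S T : Matrix (Fin n) (Fin n) ℚ) : Prop :=
  ∀ a b c d : ZMod 3, a * d - b * c = 1 →
    word S T (-c) (-d) a b = S * word S T a b c d ∧
    word S T (a + c) (b + d) c d = T * word S T a b c d

def S3 : Matrix (Fin 3) (Fin 3) ℚ := !![1,0,0; 0,-1,0; 0,0,-1]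
def S4 : Matrix (Fin 4) (Fin 4) ℚ := !![0,-1,0,0; 1,0,0,0; 0,0,0,-1; 0,0,1,0]
def T2 : Matrix (Fin 2) (Fin 2) ℚ := !![0,-1; 1,-1]
def T3 : Matrix (Fin 3) (Fin 3) ℚ := !![0,1,0; 0,0,1; 1,0,0]
def T4 : Matrix (Fin 4) (Fin 4) ℚ :=
  !![-1/2,1/2,-1/2,-1/2; -1/2,-1/2,-1/2,1/2; 1/2,1/2,-1/2,1/2; 1/2,-1/2,-1/2,-1/2]
def T5 : Matrix (Fin 4) (Fin 4) ℚ := !![1,0,0,0; 0,0,0,1; 0,1,0,0; 0,0,1,0]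

theorem word_rel {M : Type*} [Monoid M] (S T : M) (r1 : S * S * (S * S) = 1)
    (r2 : T * (T * T) = 1) (r3 : T * (S * S) = S * S * T)
    (r4 : S * (T * S) = T * (T * (S * (T * T)))) (r5 : S * (T * (T * S)) = S * S * (T * (S * T)))
    (a b c d : ZMod 3) (hdet : a * d - b * c = 1) :
    word S T (-c) (-d) a b = S * word S T a b c d ∧
    word S T (a + c) (b + d) c d = T * word S T a b c d := by
  unfold word
  have r6 : S * (S * S) = S * S * S := (mul_assoc _ _ _).symm
  generalize hZ : S * S = Z at *
  have r1' : ∀ x, Z * (Z * x) = x := fun x => by rw [← mul_assoc, r1, one_mul]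
  have r2' : ∀ x, T * (T * (T * x)) = x := fun x => by
    simpa only [mul_assoc, one_mul] using congrArg (· * x) r2
  have r3' : ∀ x, T * (Z * x) = Z * (T * x) := fun x => by
    simpa only [mul_assoc, one_mul] using congrArg (· * x) r3
  have r4' : ∀ x, S * (T * (S * x)) = T * (T * (S * (T * (T * x)))) := fun x => by
    simpa only [mul_assoc, one_mul] using congrArg (· * x) r4
  have r5' : ∀ x, S * (T * (T * (S * x))) = Z * (T * (S * (T * x))) := fun x => by
    simpa only [mul_assoc, one_mul] using congrArg (· * x) r5
  have r6' : ∀ x, S * (Z * x) = Z * (S * x) := fun x => by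
    simpa only [mul_assoc, one_mul] using congrArg (· * x) r6
  have r7 : ∀ x, S * (S * x) = Z * x := fun x => by rw [← mul_assoc, hZ]
  have tri : ∀ x : ZMod 3, x = 0 ∨ x = 1 ∨ x = 2 := by decide
  have v0 : (0 : ZMod 3).val = 0 := rfl
  have v1 : (1 : ZMod 3).val = 1 := rfl
  have v2 : (2 : ZMod 3).val = 2 := rfl
  have e1 : (2 * 2 : ZMod 3) = 1 := rfl
  have e2 : (-2 : ZMod 3) = 1 := rfl
  have e3 : (-1 : ZMod 3) = 2 := rfl
  have e4 : (1 + 1 : ZMod 3) = 2 := rfl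
  have e5 : (1 + 2 : ZMod 3) = 0 := rfl
  have e6 : (2 + 1 : ZMod 3) = 0 := rfl
  have e7 : (2 + 2 : ZMod 3) = 1 := rfl
  have n1 : (2 : ZMod 3) ≠ 0 := by decide
  have n2 : (2 : ZMod 3) ≠ 1 := by decide
  have n3 : (0 : ZMod 3) ≠ 1 := by decide
  have n4 : (1 : ZMod 3) ≠ 0 := by decide
  rcases tri a with rfl | rfl | rfl <;> rcases tri c with rfl | rfl | rfl <;>
  rcases tri b with rfl | rfl | rfl <;> rcases tri d with rfl | rfl | rfl <;>
  first
  | exact absurd hdet (by decide)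
  | simp only [e1, e2, e3, e4, e5, e6, e7, n1, n2, n3, n4, v0, v1, v2, neg_zero, if_true, if_false,
      zero_add, add_zero, mul_zero, zero_mul, mul_one, one_mul, pow_zero, pow_one, pow_two,
      mul_assoc, r1, r2, r3, r4, r5, r6, r7, r1', r2', r3', r4', r5', r6', hZ, and_self]

theorem ok1 : RepOK (1 : Matrix (Fin 1) (Fin 1) ℚ) 1 :=
  word_rel _ _ (by decide +kernel) (by decide +kernel) (by decide +kernel) (by decide +kernel)
    (by decide +kernel)
theorem ok2 : RepOK 1 T2 :=
  word_rel _ _ (by decide +kernel) (by decide +kernel) (by decide +kernel) (by decide +kernel)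
    (by decide +kernel)
theorem ok3 : RepOK S3 T3 :=
  word_rel _ _ (by decide +kernel) (by decide +kernel) (by decide +kernel) (by decide +kernel)
    (by decide +kernel)
theorem ok4 : RepOK S4 T4 :=
  word_rel _ _ (by decide +kernel) (by decide +kernel) (by decide +kernel) (by decide +kernel)
    (by decide +kernel)
theorem ok5 : RepOK S4 T5 :=
  word_rel _ _ (by decide +kernel) (by decide +kernel) (by decide +kernel) (by decide +kernel)
    (by decide +kernel)

def gS : G3 := ⟨!![0,-1;1,0], by decide⟩
def gT : G3 := ⟨!![1,1;0,1], by decide⟩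

theorem det_G3 (g : G3) : g.1 0 0 * g.1 1 1 - g.1 0 1 * g.1 1 0 = 1 := by
  have := g.2
  rwa [Matrix.det_fin_two] at this

theorem word_matrix : ∀ a b c d : ZMod 3, a * d - b * c = 1 →
    word (!![0,-1;1,0] : Matrix (Fin 2) (Fin 2) (ZMod 3)) !![1,1;0,1] a b c d = !![a,b;c,d] := by
  decide +kernel

theorem word_G3 (g : G3) : word gS gT (g.1 0 0) (g.1 0 1) (g.1 1 0) (g.1 1 1) = g := by
  apply Subtype.ext
  have h := word_matrix _ _ _ _ (det_G3 g)
  have h3 : ∀ a b c d, (word gS gT a b c d).1 = word gS.1 gT.1 a b c d := by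
    intro a b c d
    unfold word
    split_ifs <;> simp
  rw [h3]
  refine h.trans ?_
  exact (Matrix.eta_fin_two g.1).symm

/-- the matrix of `g` -/
def rmat {n : ℕ} (S T : Matrix (Fin n) (Fin n) ℚ) (g : G3) : Matrix (Fin n) (Fin n) ℚ :=
  word S T (g.1 0 0) (g.1 0 1) (g.1 1 0) (g.1 1 1)

theorem rmat_one {n : ℕ} (S T : Matrix (Fin n) (Fin n) ℚ) : rmat S T 1 = 1 := by
  simp [rmat, word]

theorem word_ind {n : ℕ} {S T : Matrix (Fin n) (Fin n) ℚ}
    (P : G3 → Matrix (Fin n) (Fin n) ℚ → Prop) (h1 : P 1 1)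
    (hm : ∀ g h x y, P g x → P h y → P (g * h) (x * y)) (hS : P gS S) (hT : P gT T) (a b c d) :
    P (word gS gT a b c d) (word S T a b c d) := by
  have hp : ∀ k : ℕ, P (gT ^ k) (T ^ k) := by
    intro k
    induction k with
    | zero => simpa using h1
    | succ k ih => rw [pow_succ, pow_succ]; exact hm _ _ _ _ ih hT
  unfold word
  split_ifs
  · exact hm _ _ _ _ h1 (hp _)
  · exact hm _ _ _ _ (hm _ _ _ _ hS hS) (hp _)
  · exact hm _ _ _ _ h1 (hm _ _ _ _ (hp _) (hm _ _ _ _ hS (hp _)))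
  · exact hm _ _ _ _ (hm _ _ _ _ hS hS) (hm _ _ _ _ (hp _) (hm _ _ _ _ hS (hp _)))

theorem mul_ent {n : ℕ} (S T : Matrix (Fin n) (Fin n) ℚ) (g h : G3) : rmat S T (g * h) =
    word S T (g.1 0 0 * h.1 0 0 + g.1 0 1 * h.1 1 0) (g.1 0 0 * h.1 0 1 + g.1 0 1 * h.1 1 1)
      (g.1 1 0 * h.1 0 0 + g.1 1 1 * h.1 1 0) (g.1 1 0 * h.1 0 1 + g.1 1 1 * h.1 1 1) := by
  have : (g * h).1 = g.1 * h.1 := rfl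
  simp only [rmat, this, Matrix.mul_apply, Fin.sum_univ_two]

theorem rmat_mul {n : ℕ} {S T : Matrix (Fin n) (Fin n) ℚ} (ok : RepOK S T) (g h : G3) :
    rmat S T (g * h) = rmat S T g * rmat S T h := by
  have key := word_ind (S := S) (T := T) (fun g x => ∀ h, rmat S T (g * h) = x * rmat S T h)
    (by simp)
    (by intro g h x y h1 h2 k; rw [mul_assoc, h1, h2, mul_assoc])
    (by
      intro h
      have := (ok _ _ _ _ (det_G3 h)).1
      rw [mul_ent]; simpa [rmat, gS] using this)
    (by
      intro h
      have := (ok _ _ _ _ (det_G3 h)).2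
      rw [mul_ent]; simpa [rmat, gT] using this)
    (g.1 0 0) (g.1 0 1) (g.1 1 0) (g.1 1 1) h
  rw [word_G3] at key
  exact key

/-- the representation given by two matrices -/
noncomputable def mkRep {n : ℕ} {S T : Matrix (Fin n) (Fin n) ℚ} (ok : RepOK S T) :
    Representation ℚ G3 (Fin n → ℚ) where
  toFun g := Matrix.toLin' (rmat S T g)
  map_one' := by rw [rmat_one, Matrix.toLin'_one]; rfl
  map_mul' g h := by rw [rmat_mul ok, Matrix.toLin'_mul]; rfl

theorem mkRep_apply {n : ℕ} {S T : Matrix (Fin n) (Fin n) ℚ} (ok : RepOK S T) (g : G3) :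
    mkRep ok g = Matrix.toLin' (rmat S T g) := rfl

theorem rmat_S {n : ℕ} (S T : Matrix (Fin n) (Fin n) ℚ) : rmat S T gS = S := by
  simp [rmat, word, gS]

theorem rmat_T {n : ℕ} (S T : Matrix (Fin n) (Fin n) ℚ) : rmat S T gT = T := by
  have : (1 : ZMod 3).val = 1 := rfl
  simp [rmat, word, gT, this]

theorem simple_of_idem {R M : Type*} [Ring R] [AddCommGroup M] [Module R M]
    [IsSemisimpleModule R M] [Nontrivial M]
    (H : ∀ e : M →ₗ[R] M, (∀ v, e (e v) = e v) → (∀ v, e v = 0) ∨ (∀ v, e v = v)) :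
    IsSimpleModule R M := by
  rw [isSimpleModule_iff]
  refine ⟨fun W => ?_⟩
  obtain ⟨f, hf⟩ := IsSemisimpleModule.extension_property W.subtype
    (Submodule.injective_subtype W) LinearMap.id
  have hf' : ∀ w : W, f w = w := fun w => DFunLike.congr_fun hf w
  have he2 : ∀ v ∈ W, ((f v : W) : M) = v := fun v hv => congrArg Subtype.val (hf' ⟨v, hv⟩)
  rcases H (W.subtype ∘ₗ f) (fun v => he2 _ (f v).2) with h | h
  · left
    rw [eq_bot_iff]
    intro v hv
    rw [Submodule.mem_bot, ← he2 v hv]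
    exact h v
  · right
    rw [eq_top_iff]
    intro v _
    have : ((f v : W) : M) = v := h v
    rw [← this]
    exact (f v).2

theorem simple_mk {n : ℕ} [NeZero n] {S T : Matrix (Fin n) (Fin n) ℚ} (ok : RepOK S T)
    (H : ∀ E : Matrix (Fin n) (Fin n) ℚ, E * S = S * E → E * T = T * E → E * E = E →
      E = 0 ∨ E = 1) : IsSimpleModule QSL₂F₃ (mkRep ok).asModule := by
  have : Nontrivial (mkRep ok).asModule := inferInstanceAs (Nontrivial (Fin n → ℚ))
  refine simple_of_idem fun e he => ?_
  let e' : (Fin n → ℚ) →ₗ[ℚ] (Fin n → ℚ) :=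
    { toFun := fun v => (mkRep ok).asModuleEquiv (e ((mkRep ok).asModuleEquiv.symm v))
      map_add' := by intro x y; simp
      map_smul' := by
        intro c x
        rw [Representation.asModuleEquiv_symm_map_smul, map_smul,
          Representation.asModuleEquiv_map_smul]
        simp }
  have hcomm : ∀ g, LinearMap.toMatrix' e' * rmat S T g = rmat S T g * LinearMap.toMatrix' e' := by
    intro g
    apply Matrix.toLin'.injective
    rw [Matrix.toLin'_mul, Matrix.toLin'_mul, Matrix.toLin'_toMatrix', ← mkRep_apply ok]
    refine LinearMap.ext fun v => ?_
    have h1 := (mkRep ok).asModuleEquiv_symm_map_rho g v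
    change (mkRep ok).asModuleEquiv (e ((mkRep ok).asModuleEquiv.symm (mkRep ok g v))) =
      mkRep ok g ((mkRep ok).asModuleEquiv (e ((mkRep ok).asModuleEquiv.symm v)))
    rw [h1, map_smul, Representation.asModuleEquiv_map_smul, Representation.asAlgebraHom_of]
  have hidem : LinearMap.toMatrix' e' * LinearMap.toMatrix' e' = LinearMap.toMatrix' e' := by
    rw [← LinearMap.toMatrix'_comp]
    congr 1
    refine LinearMap.ext fun v => ?_
    exact he v
  rcases H _ (by simpa [rmat_S] using hcomm gS) (by simpa [rmat_T] using hcomm gT) hidem with h | h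
  · left
    have h0 : e' = 0 := by
      apply LinearMap.toMatrix'.injective; rw [h, map_zero]
    exact fun v => DFunLike.congr_fun h0 v
  · right
    have h0 : e' = LinearMap.id := by
      apply LinearMap.toMatrix'.injective; rw [h, LinearMap.toMatrix'_id]
    exact fun v => DFunLike.congr_fun h0 v

theorem trace_eq {V W : Type} [AddCommGroup V] [AddCommGroup W] [Module ℚ V] [Module ℚ W]
    (ρ : Representation ℚ G3 V) (σ : Representation ℚ G3 W)
    (φ : ρ.asModule ≃ₗ[QSL₂F₃] σ.asModule) (g : G3) :
    LinearMap.trace ℚ V (ρ g) = LinearMap.trace ℚ W (σ g) := by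
  let ψ : V ≃ₗ[ℚ] W := ρ.asModuleEquiv.symm ≪≫ₗ φ.restrictScalars ℚ ≪≫ₗ σ.asModuleEquiv
  rw [← LinearMap.trace_conj' (ρ g) ψ]
  congr 1
  refine LinearMap.ext fun w => ?_
  have h1 := ρ.asModuleEquiv_symm_map_rho g (ψ.symm w)
  rw [LinearEquiv.conj_apply]
  change σ.asModuleEquiv (φ (ρ.asModuleEquiv.symm (ρ g (ψ.symm w)))) = σ g w
  rw [h1, map_smul, Representation.asModuleEquiv_map_smul, Representation.asAlgebraHom_of]
  exact congrArg (σ g) (ψ.apply_symm_apply w)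

def dimV : Fin 5 → ℕ
  | 0 => 1
  | 1 => 2
  | 2 => 3
  | 3 => 4
  | 4 => 4

def matS : (i : Fin 5) → Matrix (Fin (dimV i)) (Fin (dimV i)) ℚ
  | 0 => (1 : Matrix (Fin 1) (Fin 1) ℚ)
  | 1 => (1 : Matrix (Fin 2) (Fin 2) ℚ)
  | 2 => S3
  | 3 => S4
  | 4 => S4

def matT : (i : Fin 5) → Matrix (Fin (dimV i)) (Fin (dimV i)) ℚ
  | 0 => (1 : Matrix (Fin 1) (Fin 1) ℚ)
  | 1 => T2
  | 2 => T3
  | 3 => T4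
  | 4 => T5

theorem matOK : (i : Fin 5) → RepOK (matS i) (matT i)
  | 0 => ok1
  | 1 => ok2
  | 2 => ok3
  | 3 => ok4
  | 4 => ok5

instance (i : Fin 5) : NeZero (dimV i) := ⟨by fin_cases i <;> decide⟩

def mult : Fin 5 → ℚ
  | 0 => 1
  | 1 => 1
  | 2 => 3
  | 3 => 1
  | 4 => 2

theorem reg_trace : ∀ a b c d : ZMod 3, a * d - b * c = 1 →
    ∑ i, mult i * (word (matS i) (matT i) a b c d).trace =
      if a = 1 ∧ b = 0 ∧ c = 0 ∧ d = 1 then 24 else 0 := by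
  decide +kernel

theorem reg_trace' (g : G3) :
    ∑ i, mult i * (rmat (matS i) (matT i) g).trace = if g = 1 then 24 else 0 := by
  refine (reg_trace _ _ _ _ (det_G3 g)).trans ?_
  congr 1
  rw [Matrix.SpecialLinearGroup.ext_iff]
  simp [Fin.forall_fin_two, and_assoc]

/-- the five representations -/
noncomputable def rep (i : Fin 5) : Representation ℚ G3 (Fin (dimV i) → ℚ) := mkRep (matOK i)

theorem coeff_eq (r : QSL₂F₃) :
    ∑ i, mult i * LinearMap.trace ℚ _ ((rep i).asAlgebraHom r) = 24 * r.coeff 1 := by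
  induction r using MonoidAlgebra.induction_linear with
  | zero => simp
  | add f g hf hg => simp only [map_add, mul_add, Finset.sum_add_distrib, hf, hg]; simp [mul_add]
  | single g c =>
    have := reg_trace' g
    simp only [Representation.asAlgebraHom_single, map_smul, rep, mkRep_apply,
      Matrix.trace_toLin'_eq, smul_eq_mul]
    simp only [mul_left_comm _ c, ← Finset.mul_sum]
    rw [this, MonoidAlgebra.coeff_single, Finsupp.single_apply]
    split_ifs <;> ring

theorem faithful (r : QSL₂F₃) (h : ∀ i, (rep i).asAlgebraHom r = 0) : r = 0 := by
  ext g
  have := coeff_eq (r * MonoidAlgebra.single g⁻¹ 1)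
  simpa [h] using this

theorem exhaust (hs : ∀ i, IsSimpleModule QSL₂F₃ (rep i).asModule)
    (U : Type u) [AddCommGroup U] [Module QSL₂F₃ U] (hU : IsSimpleModule QSL₂F₃ U) :
    ∃ i, Nonempty (U ≃ₗ[QSL₂F₃] (rep i).asModule) := by
  have : Nontrivial U := IsSimpleModule.nontrivial QSL₂F₃ U
  obtain ⟨u, hu⟩ := exists_ne (0 : U)
  have hsurj : Function.Surjective (LinearMap.toSpanSingleton QSL₂F₃ U u) :=
    IsSimpleModule.toSpanSingleton_surjective QSL₂F₃ hu
  have := Module.projective_of_isSemisimpleRing QSL₂F₃ U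
  obtain ⟨s, hs'⟩ := Module.projective_lifting_property (LinearMap.toSpanSingleton QSL₂F₃ U u)
    LinearMap.id hsurj
  have hne : s u ≠ 0 := by
    intro h0
    have := DFunLike.congr_fun hs' u
    simp [h0] at this
    exact hu this.symm
  have : ∃ i, (rep i).asAlgebraHom (s u) ≠ 0 := by
    by_contra! hc
    exact hne (faithful _ hc)
  obtain ⟨i, hi⟩ := this
  have : ∃ v : (rep i).asModule, s u • v ≠ 0 := by
    by_contra! hc
    exact hi (LinearMap.ext fun v => hc v)
  obtain ⟨v, hv⟩ := this
  refine ⟨i, ⟨LinearEquiv.ofBijective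
    ((LinearMap.toSpanSingleton QSL₂F₃ (rep i).asModule v) ∘ₗ s) ?_⟩⟩
  have := hs i
  apply LinearMap.bijective_of_ne_zero
  intro h0
  exact hv (DFunLike.congr_fun h0 u)

theorem idem1 (E : Matrix (Fin 1) (Fin 1) ℚ) (h : E * E = E) : E = 0 ∨ E = 1 := by
  have h00 := congrFun (congrFun h 0) 0
  have h00 : E 0 0 = 1 ∨ E 0 0 = 0 := by
    have h1 : E 0 0 * E 0 0 = E 0 0 := by simpa [Matrix.mul_apply] using h00
    have h2 : (E 0 0 - 1) * E 0 0 = 0 := by linarith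
    rcases mul_eq_zero.1 h2 with h | h
    · left; linarith
    · right; exact h
  rcases h00 with h' | h'
  · right; ext i j; fin_cases i; fin_cases j; simpa using h'
  · left; ext i j; fin_cases i; fin_cases j; simpa using h'

theorem idem2 (E : Matrix (Fin 2) (Fin 2) ℚ) (hT : E * T2 = T2 * E) (h : E * E = E) :
    E = 0 ∨ E = 1 := by
  simp only [← Matrix.ext_iff, Fin.forall_fin_two, Matrix.mul_apply, Fin.sum_univ_two, T2] at *
  simp at *
  obtain ⟨⟨_, _⟩, _, _⟩ := hT
  obtain ⟨⟨h1, h2⟩, h3, h4⟩ := h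
  generalize E 0 0 = a at *
  generalize E 0 1 = b at *
  generalize E 1 0 = c at *
  generalize E 1 1 = d at *
  obtain rfl : b = -c := by linarith
  obtain rfl : d = a - c := by linarith
  have hc : c = 0 := by
    have h5 : c * (2 * a - c - 1) = 0 := by linarith
    rcases mul_eq_zero.1 h5 with h | h
    · exact h
    · have : a = (1 + c) / 2 := by linarith
      subst this
      nlinarith [sq_nonneg c]
  subst hc
  have : a * (a - 1) = 0 := by linarith
  rcases mul_eq_zero.1 this with h | h
  · left; simp [h]
  · right; have : a = 1 := by linarith
    simp [this]

theorem idem3 (E : Matrix (Fin 3) (Fin 3) ℚ) (hS : E * S3 = S3 * E) (hT : E * T3 = T3 * E)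
    (h : E * E = E) : E = 0 ∨ E = 1 := by
  simp only [← Matrix.ext_iff, Fin.forall_fin_succ, Matrix.mul_apply, Fin.sum_univ_succ, S3, T3]
    at *
  simp at *
  obtain ⟨⟨_, _⟩, _, _⟩ := hS
  obtain ⟨⟨_, _, _⟩, ⟨_, _, _⟩, _, _, _⟩ := hT
  have e01 : E 0 1 = 0 := by linarith
  have e02 : E 0 2 = 0 := by linarith
  have e10 : E 1 0 = 0 := by linarith
  have e20 : E 2 0 = 0 := by linarith
  have e12 : E 1 2 = 0 := by linarith
  have e21 : E 2 1 = 0 := by linarith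
  have e11 : E 1 1 = E 0 0 := by linarith
  have e22 : E 2 2 = E 0 0 := by linarith
  simp only [e01, e02, e10, e20, e12, e21, e11, e22] at h ⊢
  have h5 : E 0 0 * (E 0 0 - 1) = 0 := by linarith [h.1.1]
  rcases mul_eq_zero.1 h5 with h | h
  · left; simp [h]
  · right; have h6 : E 0 0 = 1 := by linarith
    simp [h6]

def J4 : Matrix (Fin 4) (Fin 4) ℚ := !![0,0,1,0; 0,0,0,-1; -1,0,0,0; 0,1,0,0]

theorem J4_eq : T4 * S4 * (T4 * T4) = J4 := by decide +kernel

theorem idem4 (E : Matrix (Fin 4) (Fin 4) ℚ) (hS : E * S4 = S4 * E) (hT : E * T4 = T4 * E)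
    (h : E * E = E) : E = 0 ∨ E = 1 := by
  have hJ : E * J4 = J4 * E := by
    rw [← J4_eq]
    exact (Commute.mul_right (Commute.mul_right hT hS) (Commute.mul_right hT hT))
  clear hT
  simp only [← Matrix.ext_iff, Fin.forall_fin_succ, Matrix.mul_apply, Fin.sum_univ_succ, S4, J4]
    at *
  simp at *
  obtain ⟨⟨_, _, _, _⟩, ⟨_, _, _, _⟩, ⟨_, _, _, _⟩, _, _, _, _⟩ := hS
  obtain ⟨⟨_, _, _, _⟩, ⟨_, _, _, _⟩, ⟨_, _, _, _⟩, _, _, _, _⟩ := hJ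
  have e01 : E 0 1 = -E 1 0 := by linarith
  have e11 : E 1 1 = E 0 0 := by linarith
  have e21 : E 2 1 = -E 3 0 := by linarith
  have e31 : E 3 1 = E 2 0 := by linarith
  have e02 : E 0 2 = -E 2 0 := by linarith
  have e12 : E 1 2 = E 3 0 := by linarith
  have e22 : E 2 2 = E 0 0 := by linarith
  have e32 : E 3 2 = -E 1 0 := by linarith
  have e03 : E 0 3 = -E 3 0 := by linarith
  have e13 : E 1 3 = -E 2 0 := by linarith
  have e23 : E 2 3 = E 1 0 := by linarith
  have e33 : E 3 3 = E 0 0 := by linarith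
  simp only [e01, e11, e21, e31, e02, e12, e22, e32, e03, e13, e23, e33] at h ⊢
  obtain ⟨⟨h0, _⟩, ⟨h1, _⟩, ⟨h2, _⟩, h3, _⟩ := h
  generalize E 0 0 = a at *
  generalize E 1 0 = b at *
  generalize E 2 0 = c at *
  generalize E 3 0 = d at *
  by_cases ha : 2 * a - 1 = 0
  · exfalso
    have : a = 1 / 2 := by linarith
    subst this
    clear * - h0
    nlinarith [sq_nonneg b, sq_nonneg c, sq_nonneg d]
  · have hb : b = 0 := (mul_eq_zero.1 (by linarith : (2 * a - 1) * b = 0)).resolve_left ha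
    have hc : c = 0 := (mul_eq_zero.1 (by linarith : (2 * a - 1) * c = 0)).resolve_left ha
    have hd : d = 0 := (mul_eq_zero.1 (by linarith : (2 * a - 1) * d = 0)).resolve_left ha
    subst hb hc hd
    have h5 : a * (a - 1) = 0 := by linarith
    rcases mul_eq_zero.1 h5 with h | h
    · left; simp [h]
    · right; have h6 : a = 1 := by linarith
      simp [h6]

theorem idem5 (E : Matrix (Fin 4) (Fin 4) ℚ) (hS : E * S4 = S4 * E) (hT : E * T5 = T5 * E)
    (h : E * E = E) : E = 0 ∨ E = 1 := by
  simp only [← Matrix.ext_iff, Fin.forall_fin_succ, Matrix.mul_apply, Fin.sum_univ_succ, S4, T5]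
    at *
  simp at *
  obtain ⟨⟨_, _, _, _⟩, ⟨_, _, _, _⟩, ⟨_, _, _, _⟩, _, _, _, _⟩ := hS
  obtain ⟨HT, ⟨_, _, _, _⟩, ⟨_, _, _, _⟩, _, _, _, _⟩ := hT
  obtain ⟨_, _, _⟩ := HT
  have e20 : E 2 0 = E 1 0 := by linarith
  have e30 : E 3 0 = E 1 0 := by linarith
  have e01 : E 0 1 = -E 1 0 := by linarith
  have e02 : E 0 2 = -E 1 0 := by linarith
  have e03 : E 0 3 = -E 1 0 := by linarith
  have e12 : E 1 2 = E 1 0 := by linarith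
  have e21 : E 2 1 = -E 1 0 := by linarith
  have e13 : E 1 3 = -E 1 0 := by linarith
  have e31 : E 3 1 = E 1 0 := by linarith
  have e23 : E 2 3 = E 1 0 := by linarith
  have e32 : E 3 2 = -E 1 0 := by linarith
  have e11 : E 1 1 = E 0 0 := by linarith
  have e22 : E 2 2 = E 0 0 := by linarith
  have e33 : E 3 3 = E 0 0 := by linarith
  simp only [e20, e30, e01, e02, e03, e12, e21, e13, e31, e23, e32, e11, e22, e33] at h ⊢
  obtain ⟨⟨h0, _⟩, ⟨h1, _⟩, _⟩ := h
  generalize E 0 0 = a at *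
  generalize E 1 0 = b at *
  by_cases ha : 2 * a - 1 = 0
  · exfalso
    have : a = 1 / 2 := by linarith
    subst this
    clear * - h0
    nlinarith [sq_nonneg b]
  · have hb : b = 0 := (mul_eq_zero.1 (by linarith : (2 * a - 1) * b = 0)).resolve_left ha
    subst hb
    have h5 : a * (a - 1) = 0 := by linarith
    rcases mul_eq_zero.1 h5 with h | h
    · left; simp [h]
    · right; have h6 : a = 1 := by linarith
      simp [h6]

theorem simple_rep (i : Fin 5) : IsSimpleModule QSL₂F₃ (rep i).asModule := by
  apply simple_mk
  intro E hS hT h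
  match i, E, hS, hT, h with
  | 0, E, _, _, h => exact idem1 E h
  | 1, E, _, hT, h => exact idem2 E hT h
  | 2, E, hS, hT, h => exact idem3 E hS hT h
  | 3, E, hS, hT, h => exact idem4 E hS hT h
  | 4, E, hS, hT, h => exact idem5 E hS hT h

theorem noniso (i j : Fin 5) (h : i ≠ j) :
    IsEmpty ((rep i).asModule ≃ₗ[QSL₂F₃] (rep j).asModule) := by
  refine ⟨fun φ => ?_⟩
  have h1 := trace_eq _ _ φ 1
  have h2 := trace_eq _ _ φ gT
  simp only [rep, mkRep_apply, rmat_one, rmat_T, Matrix.trace_toLin'_eq] at h1 h2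
  have key : ∀ i j, i ≠ j → (1 : Matrix (Fin (dimV i)) (Fin (dimV i)) ℚ).trace =
      (1 : Matrix (Fin (dimV j)) (Fin (dimV j)) ℚ).trace → (matT i).trace ≠ (matT j).trace := by
    decide +kernel
  exact key i j h h1 h2

theorem stmt14 :
    ∃ (V : Fin 5 → Type) (_ : ∀ i, AddCommGroup (V i)) (_ : ∀ i, Module QSL₂F₃ (V i)),
      (∀ i, IsSimpleModule QSL₂F₃ (V i)) ∧
      (∀ i j, i ≠ j → IsEmpty (V i ≃ₗ[QSL₂F₃] V j)) ∧
      ∀ (U : Type u) [AddCommGroup U] [Module QSL₂F₃ U], IsSimpleModule QSL₂F₃ U →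
        ∃ i, Nonempty (U ≃ₗ[QSL₂F₃] V i) :=
  ⟨fun i => (rep i).asModule, fun _ => inferInstance, fun _ => inferInstance,
    simple_rep, noniso, fun U _ _ hU => exhaust simple_rep U hU⟩
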